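/- Let G be a finite simple graph and let A, B ⊆ V(G) be disjoint vertex sets. If X and Y are minimum (A,B)-cuts in G, then δ(reach(A,X) ∪ reach(A,Y)) and δ(reach(A,X) ∩ reach(A,Y)) are also minimum (A,B)-cuts in G. -/

import Mathlib

/-- `X` is an `(A,B)`-cut in `G`: a set of edges of `G` whose deletion leaves no
connected component containing both a vertex of `A` and a vertex of `B`. -/
def IsCut {V : Type*} (G : SimpleGraph V) (A B : Set V) (X : Set (Sym2 V)) : Prop :=
  X ⊆ G.edgeSet ∧ ∀ a ∈ A, ∀ b ∈ B, ¬ (G.deleteEdges X).Reachable a b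

/-- `X` is a minimum `(A,B)`-cut: an `(A,B)`-cut of smallest possible cardinality. -/
def IsMinCut {V : Type*} (G : SimpleGraph V) (A B : Set V) (X : Set (Sym2 V)) : Prop :=
  IsCut G A B X ∧ ∀ Y : Set (Sym2 V), IsCut G A B Y → X.ncard ≤ Y.ncard

/-- `reach G A X` is the set of vertices lying in a connected component of `G − X`
containing a vertex of `A`. -/
def reach {V : Type*} (G : SimpleGraph V) (A : Set V) (X : Set (Sym2 V)) : Set V :=
  {v | ∃ a ∈ A, (G.deleteEdges X).Reachable a v}

/-- `edgeBoundary G Q` is the set `δ(Q)` of edges of `G` with exactly one endpoint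
in `Q`. -/
def edgeBoundary {V : Type*} (G : SimpleGraph V) (Q : Set V) : Set (Sym2 V) :=
  {e | e ∈ G.edgeSet ∧ ∃ u v : V, e = s(u, v) ∧ u ∈ Q ∧ v ∉ Q}

theorem mem_edgeBoundary_mk {V : Type*} (G : SimpleGraph V) (Q : Set V) (u v : V) :
    s(u, v) ∈ edgeBoundary G Q ↔ G.Adj u v ∧ (u ∈ Q ∧ v ∉ Q ∨ v ∈ Q ∧ u ∉ Q) := by
  simp only [edgeBoundary, Set.mem_ofPred_eq, SimpleGraph.mem_edgeSet, Sym2.eq_iff]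
  refine and_congr_right fun _ => ⟨?_, ?_⟩
  · rintro ⟨x, y, ⟨rfl, rfl⟩ | ⟨rfl, rfl⟩, hx, hy⟩
    · exact Or.inl ⟨hx, hy⟩
    · exact Or.inr ⟨hx, hy⟩
  · rintro (⟨hu, hv⟩ | ⟨hv, hu⟩)
    · exact ⟨u, v, Or.inl ⟨rfl, rfl⟩, hu, hv⟩
    · exact ⟨v, u, Or.inr ⟨rfl, rfl⟩, hv, hu⟩

theorem isCut_edgeBoundary {V : Type*} (G : SimpleGraph V) {A B Q : Set V}
    (hA : A ⊆ Q) (hB : Disjoint Q B) : IsCut G A B (edgeBoundary G Q) := by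
  refine ⟨fun e he => he.1, fun a ha b hb ⟨w⟩ => ?_⟩
  suffices h : ∀ {x y : V}, (G.deleteEdges (edgeBoundary G Q)).Walk x y → x ∈ Q → y ∈ Q from
    Set.disjoint_left.mp hB (h w (hA ha)) hb
  intro x y p
  induction p with
  | nil => exact id
  | cons hadj _ ih =>
    intro hx
    rw [SimpleGraph.deleteEdges_adj, mem_edgeBoundary_mk] at hadj
    exact ih (by_contra fun hy => hadj.2 ⟨hadj.1, Or.inl ⟨hx, hy⟩⟩)

theorem subset_reach {V : Type*} (G : SimpleGraph V) (A : Set V) (X : Set (Sym2 V)) :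
    A ⊆ reach G A X :=
  fun a ha => ⟨a, ha, SimpleGraph.Reachable.refl a⟩

theorem IsCut.disjoint_reach {V : Type*} {G : SimpleGraph V} {A B : Set V}
    {X : Set (Sym2 V)} (hX : IsCut G A B X) : Disjoint (reach G A X) B :=
  Set.disjoint_left.mpr fun b ⟨a, ha, hab⟩ hb => hX.2 a ha b hb hab

theorem edgeBoundary_reach_subset {V : Type*} (G : SimpleGraph V) (A : Set V)
    (X : Set (Sym2 V)) : edgeBoundary G (reach G A X) ⊆ X := by
  rintro _ ⟨he, u, v, rfl, ⟨a, ha, hau⟩, hv⟩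
  by_contra hX
  exact hv ⟨a, ha, hau.trans
    (SimpleGraph.Adj.reachable (SimpleGraph.deleteEdges_adj.mpr ⟨he, hX⟩))⟩

/-- The cut function `Q ↦ |δ(Q)|` is submodular. -/
theorem ncard_edgeBoundary_union_add_inter_le {V : Type*} [Finite V] (G : SimpleGraph V)
    (P Q : Set V) :
    (edgeBoundary G (P ∪ Q)).ncard + (edgeBoundary G (P ∩ Q)).ncard ≤
      (edgeBoundary G P).ncard + (edgeBoundary G Q).ncard := by
  rw [← Set.ncard_union_add_ncard_inter (edgeBoundary G (P ∪ Q)),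
    ← Set.ncard_union_add_ncard_inter (edgeBoundary G P)]
  refine Nat.add_le_add (Set.ncard_le_ncard fun e => ?_) (Set.ncard_le_ncard fun e => ?_)
  all_goals
    induction e with | _ u v
    simp only [Set.mem_union, Set.mem_inter_iff, mem_edgeBoundary_mk]
    tauto

/-- (Submodularity of cuts.) If `X` and `Y` are minimum `(A,B)`-cuts,
then `δ(reach(A,X) ∪ reach(A,Y))` and `δ(reach(A,X) ∩ reach(A,Y))` are also minimum
`(A,B)`-cuts. -/
theorem union_inter_reach_minCut {V : Type*} [Fintype V] (G : SimpleGraph V)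
    (A B : Set V) (hAB : Disjoint A B) (X Y : Set (Sym2 V))
    (hX : IsMinCut G A B X) (hY : IsMinCut G A B Y) :
    IsMinCut G A B (edgeBoundary G (reach G A X ∪ reach G A Y)) ∧
      IsMinCut G A B (edgeBoundary G (reach G A X ∩ reach G A Y)) := by
  have hU := isCut_edgeBoundary G
    ((subset_reach G A X).trans (Set.subset_union_left (t := reach G A Y)))
    (hX.1.disjoint_reach.union_left hY.1.disjoint_reach)
  have hI := isCut_edgeBoundary G
    (Set.subset_inter (subset_reach G A X) (subset_reach G A Y))
    (hX.1.disjoint_reach.mono_left Set.inter_subset_left)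
  have hsub := ncard_edgeBoundary_union_add_inter_le G (reach G A X) (reach G A Y)
  have hX_le := Set.ncard_le_ncard (edgeBoundary_reach_subset G A X)
  have hY_le := Set.ncard_le_ncard (edgeBoundary_reach_subset G A Y)
  have hYU := hY.2 _ hU
  have hYI := hY.2 _ hI
  refine ⟨⟨hU, fun Z hZ => ?_⟩, ⟨hI, fun Z hZ => ?_⟩⟩ <;>
  · have hXZ := hX.2 Z hZ
    omega
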